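/- Let u : Ω → ℝ be a measurable function on an open set Ω ⊂ ℝⁿ, finite a.e., such that T_k(u) ∈ W^{1,p}_loc(Ω) for all k > 0. Then the a.e.-defined function ∇u given by ∇u(x) = D(T_k u)(x) whenever |u(x)| < k is well defined, i.e., for k ≤ m, D(T_k u) = D(T_m u) a.e. on the set {|u| < k}. -/

import Mathlib

open MeasureTheory

/-- The truncation operator `T_k(s) = max (-k) (min s k)`. -/
noncomputable def trunc (k s : ℝ) : ℝ := max (-k) (min s k)

/-- `g` is the weak (distributional) gradient of `f` on the open set `Ω ⊆ ℝⁿ`. -/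
def HasWeakGradientOn (n : ℕ) (f : EuclideanSpace ℝ (Fin n) → ℝ)
    (g : EuclideanSpace ℝ (Fin n) → EuclideanSpace ℝ (Fin n))
    (Ω : Set (EuclideanSpace ℝ (Fin n))) : Prop :=
  MeasureTheory.LocallyIntegrableOn f Ω volume ∧
  MeasureTheory.LocallyIntegrableOn g Ω volume ∧
    ∀ φ : EuclideanSpace ℝ (Fin n) → ℝ, ContDiff ℝ (⊤ : ℕ∞) φ → HasCompactSupport φ →
      tsupport φ ⊆ Ω → ∫ x in Ω, f x • gradient φ x = - ∫ x in Ω, φ x • g x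

section Helpers
open Filter Topology ContinuousLinearMap Convolution

lemma gdct {α : Type*} [MeasurableSpace α] {μ : Measure α} {h G : ℕ → α → ℝ} {h0 G0 : α → ℝ}
    (hm : ∀ j, AEStronglyMeasurable (h j) μ) (hGi : ∀ j, Integrable (G j) μ)
    (hG0 : Integrable G0 μ) (hb : ∀ j, ∀ᵐ x ∂μ, |h j x| ≤ G j x)
    (hl : ∀ᵐ x ∂μ, Tendsto (fun j => h j x) atTop (𝓝 (h0 x)))
    (hGl : ∀ᵐ x ∂μ, Tendsto (fun j => G j x) atTop (𝓝 (G0 x)))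
    (hInteg : Tendsto (fun j => ∫ x, G j x ∂μ) atTop (𝓝 (∫ x, G0 x ∂μ))) :
    Tendsto (fun j => ∫ x, h j x ∂μ) atTop (𝓝 (∫ x, h0 x ∂μ)) := by
  have hb' : ∀ᵐ x ∂μ, ∀ j, |h j x| ≤ G j x := ae_all_iff.2 hb
  have hG0pos : ∀ᵐ x ∂μ, |h0 x| ≤ G0 x := by
    filter_upwards [hb', hl, hGl] with x h1 h2 h3
    exact le_of_tendsto_of_tendsto' h2.abs h3 h1
  have hhi : ∀ j, Integrable (h j) μ := fun j => (hGi j).mono' (hm j) (hb j)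
  have hcm : ∀ j, AEStronglyMeasurable (fun x => max (-G0 x) (min (h j x) (G0 x))) μ := fun j =>
    (hG0.1.neg).sup ((hm j).inf hG0.1)
  have hcb : ∀ j, ∀ᵐ x ∂μ, ‖max (-G0 x) (min (h j x) (G0 x))‖ ≤ G0 x := by
    intro j
    filter_upwards [hG0pos] with x hx
    have := (abs_nonneg _).trans hx
    rw [Real.norm_eq_abs, abs_le]
    exact ⟨le_max_left _ _, max_le (by linarith) (min_le_right _ _)⟩
  have t1 : Tendsto (fun j => ∫ x, max (-G0 x) (min (h j x) (G0 x)) ∂μ) atTop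
      (𝓝 (∫ x, h0 x ∂μ)) := by
    refine tendsto_integral_of_dominated_convergence G0 hcm hG0 hcb ?_
    filter_upwards [hG0pos, hl] with x hx hx2
    have := abs_le.1 hx
    have e : h0 x = max (-G0 x) (min (h0 x) (G0 x)) := by
      rw [min_eq_left this.2, max_eq_right this.1]
    conv => arg 3; rw [e]
    exact tendsto_const_nhds.max (hx2.min tendsto_const_nhds)
  have t2 : Tendsto (fun j => ∫ x, max (G0 x - G j x) 0 ∂μ) atTop (𝓝 (∫ x, (0:ℝ) ∂μ)) := by
    refine tendsto_integral_of_dominated_convergence G0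
      (fun j => ((hG0.sub (hGi j)).pos_part).1) hG0 ?_ ?_
    · intro j
      filter_upwards [hb j, hG0pos] with x h1 h2
      have := (abs_nonneg _).trans h1
      have := (abs_nonneg _).trans h2
      rw [Real.norm_eq_abs, abs_of_nonneg (le_max_right _ _)]
      exact max_le (by linarith) (by linarith)
    · filter_upwards [hGl] with x hx
      have : Tendsto (fun j => max (G0 x - G j x) 0) atTop (𝓝 (max (G0 x - G0 x) 0)) :=
        (tendsto_const_nhds.sub hx).max tendsto_const_nhds
      simpa using this
  have t3 : Tendsto (fun j => ∫ x, max (G j x - G0 x) 0 ∂μ) atTop (𝓝 0) := by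
    have e : ∀ j, ∫ x, max (G j x - G0 x) 0 ∂μ
        = (∫ x, G j x ∂μ - ∫ x, G0 x ∂μ) + ∫ x, max (G0 x - G j x) 0 ∂μ := by
      intro j
      have i1 : Integrable (fun x => G j x - G0 x) μ := (hGi j).sub hG0
      have i2 : Integrable (fun x => max (G0 x - G j x) 0) μ := (hG0.sub (hGi j)).pos_part
      rw [← integral_sub (hGi j) hG0, ← integral_add i1 i2]
      congr 1; ext x
      rcases le_total (G j x) (G0 x) with h | h
      · rw [max_eq_right (by linarith), max_eq_left (by linarith)]; ring
      · rw [max_eq_left (by linarith), max_eq_right (by linarith)]; ring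
    simp_rw [e]
    have := (hInteg.sub_const (∫ x, G0 x ∂μ)).add t2
    simpa using this
  have t4 : Tendsto (fun j => ∫ x, (h j x - max (-G0 x) (min (h j x) (G0 x))) ∂μ) atTop (𝓝 0) := by
    refine squeeze_zero_norm (fun j => ?_) t3
    refine norm_integral_le_of_norm_le (((hGi j).sub hG0).pos_part) ?_
    filter_upwards [hb j, hG0pos] with x h1 h2
    have h3 := abs_le.1 h1
    have h4 := (abs_nonneg _).trans h2
    have := le_max_left (G j x - G0 x) 0
    have := le_max_right (G j x - G0 x) 0
    rw [Real.norm_eq_abs, abs_le]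
    rcases le_total (h j x) (G0 x) with h5 | h5
    · rw [min_eq_left h5]
      rcases le_total (h j x) (-G0 x) with h' | h'
      · rw [max_eq_left h']; constructor <;> linarith
      · rw [max_eq_right h']; constructor <;> linarith
    · rw [min_eq_right h5, max_eq_right (a := -G0 x) (by linarith)]; constructor <;> linarith
  have := t4.add t1
  rw [zero_add] at this
  refine this.congr fun j => ?_
  have hci : Integrable (fun x => max (-G0 x) (min (h j x) (G0 x))) μ := hG0.mono' (hcm j) (hcb j)
  rw [integral_sub (hhi j) hci]; ring

section
variable {E : Type*} [NormedAddCommGroup E] [NormedSpace ℝ E] [FiniteDimensional ℝ E]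
  [MeasurableSpace E] [BorelSpace E] {μ : Measure E} [μ.IsAddHaarMeasure]

lemma fderiv_moll {Ω K : Set E} {f g : E → ℝ} {v : E} (hK : IsCompact K) (hKΩ : K ⊆ Ω)
    (hf : LocallyIntegrableOn f Ω μ)
    (hfg : ∀ φ : E → ℝ, ContDiff ℝ (⊤ : ℕ∞) φ → HasCompactSupport φ →
      tsupport φ ⊆ Ω → ∫ x in Ω, f x * fderiv ℝ φ x v ∂μ = - ∫ x in Ω, φ x * g x ∂μ)
    (ρ : ContDiffBump (0 : E)) (x : E) (hx : Metric.closedBall x ρ.rOut ⊆ K) :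
    HasFDerivAt (ρ.normed μ ⋆[lsmul ℝ ℝ, μ] K.indicator f)
      (fderiv ℝ (ρ.normed μ ⋆[lsmul ℝ ℝ, μ] K.indicator f) x) x ∧
    fderiv ℝ (ρ.normed μ ⋆[lsmul ℝ ℝ, μ] K.indicator f) x v =
      (ρ.normed μ ⋆[lsmul ℝ ℝ, μ] K.indicator g) x := by
  have hKm : MeasurableSet K := hK.isClosed.measurableSet
  have hfi : Integrable (K.indicator f) μ :=
    (integrable_indicator_iff hKm).2 (hf.integrableOn_compact_subset hKΩ hK)
  have hρ1 : ContDiff ℝ 1 (ρ.normed μ) := ρ.contDiff_normed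
  have hd := ρ.hasCompactSupport_normed (μ := μ) |>.hasFDerivAt_convolution_left
    (lsmul ℝ ℝ) hρ1 hfi.locallyIntegrable x
  refine ⟨hd.differentiableAt.hasFDerivAt, ?_⟩
  rw [hd.fderiv]
  have hψd : ∀ y, HasFDerivAt (fun y => ρ.normed μ (x - y)) (-(fderiv ℝ (ρ.normed μ) (x - y))) y := by
    intro y
    have h1 := (hρ1.differentiable one_ne_zero (x - y)).hasFDerivAt
    have h2 : HasFDerivAt (fun y => x - y) (-(ContinuousLinearMap.id ℝ E)) y :=
      (hasFDerivAt_id y).const_sub x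
    have := h1.comp y h2
    simpa [Function.comp_def] using this
  have hzero : ∀ y, y ∉ Metric.closedBall x ρ.rOut →
      ρ.normed μ (x - y) = 0 ∧ fderiv ℝ (ρ.normed μ) (x - y) = 0 := by
    intro y hy
    have : x - y ∉ tsupport (ρ.normed μ) := by
      rw [ρ.tsupport_normed_eq]
      simpa [dist_eq_norm, norm_sub_rev] using hy
    exact ⟨image_eq_zero_of_notMem_tsupport this, by
      by_contra h
      exact this (support_fderiv_subset ℝ (by simpa using h))⟩
  have hts : tsupport (fun y => ρ.normed μ (x - y)) ⊆ Metric.closedBall x ρ.rOut := by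
    refine closure_minimal ?_ Metric.isClosed_closedBall
    intro y hy
    by_contra h
    exact hy (hzero y h).1
  have hcs : HasCompactSupport (fun y => ρ.normed μ (x - y)) :=
    (isCompact_closedBall x ρ.rOut).of_isClosed_subset (isClosed_tsupport _) hts
  have key := hfg (fun y => ρ.normed μ (x - y))
    (ρ.contDiff_normed.comp (contDiff_const.sub contDiff_id)) hcs (hts.trans (hx.trans hKΩ))
  simp_rw [fun y => (hψd y).fderiv] at key
  have e1 : ((fderiv ℝ (ρ.normed μ) ⋆[(lsmul ℝ ℝ).precompL E, μ] K.indicator f) x) v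
      = ∫ y, fderiv ℝ (ρ.normed μ) (x - y) v * K.indicator f y ∂μ := by
    rw [convolution_eq_swap]
    have hInteg : Integrable (fun t => ((lsmul ℝ ℝ).precompL E (fderiv ℝ (ρ.normed μ) (x - t)))
        (K.indicator f t)) μ := by
      have hc : Continuous (fderiv ℝ (ρ.normed μ)) := hρ1.continuous_fderiv one_ne_zero
      have := (ρ.hasCompactSupport_normed (μ := μ)).fderiv ℝ |>.convolutionExists_left
        ((lsmul ℝ ℝ).precompL E) hc hfi.locallyIntegrable x
      exact this.integrable_swap
    rw [ContinuousLinearMap.integral_apply hInteg]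
    simp [ContinuousLinearMap.precompL_apply]
  rw [e1, convolution_eq_swap]
  have hKcase : ∀ y, y ∉ K → y ∉ Metric.closedBall x ρ.rOut := fun y h h' => h (hx h')
  have e2 : ∫ y, fderiv ℝ (ρ.normed μ) (x - y) v * K.indicator f y ∂μ
      = - ∫ y in Ω, f y * (-(fderiv ℝ (ρ.normed μ) (x - y))) v ∂μ := by
    rw [← integral_neg, ← setIntegral_eq_integral_of_forall_compl_eq_zero (s := Ω)]
    · congr 1; ext y
      by_cases hy : y ∈ K
      · simp [hy]; ring
      · simp [hy, (hzero y (hKcase y hy)).2]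
    · intro y hy
      have : y ∉ K := fun h => hy (hKΩ h)
      simp [this]
  have e3 : ∫ t, (lsmul ℝ ℝ) (ρ.normed μ (x - t)) (K.indicator g t) ∂μ
      = ∫ y in Ω, ρ.normed μ (x - y) * g y ∂μ := by
    rw [← setIntegral_eq_integral_of_forall_compl_eq_zero (s := Ω)]
    · congr 1; ext y
      by_cases hy : y ∈ K
      · simp [hy]
      · simp [hy, (hzero y (hKcase y hy)).1]
    · intro y hy
      have : y ∉ K := fun h => hy (hKΩ h)
      simp [this]
  rw [e2, e3, key, neg_neg]


lemma chain_rule {Ω : Set E} {f g : E → ℝ} {v : E} (hΩ : IsOpen Ω)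
    (hf : LocallyIntegrableOn f Ω μ) (hg : LocallyIntegrableOn g Ω μ)
    (hfg : ∀ φ : E → ℝ, ContDiff ℝ (⊤ : ℕ∞) φ → HasCompactSupport φ →
      tsupport φ ⊆ Ω → ∫ x in Ω, f x * fderiv ℝ φ x v ∂μ = - ∫ x in Ω, φ x * g x ∂μ)
    {F : ℝ → ℝ} (hF : ContDiff ℝ 1 F) {C : ℝ} (hFC : ∀ t, |F t| ≤ C)
    (hF' : ∀ t, |deriv F t| ≤ 1) {φ : E → ℝ} (hφ : ContDiff ℝ (⊤ : ℕ∞) φ)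
    (hφc : HasCompactSupport φ) (hφΩ : tsupport φ ⊆ Ω) :
    ∫ x, F (f x) * fderiv ℝ φ x v ∂μ = - ∫ x, deriv F (f x) * g x * φ x ∂μ := by
  obtain ⟨r, hr, hrΩ⟩ := hφc.isCompact.exists_cthickening_subset_open hΩ hφΩ
  set K := Metric.cthickening r (tsupport φ) with hKdef
  have hK : IsCompact K := hφc.isCompact.cthickening
  have hsub : tsupport φ ⊆ K := Metric.self_subset_cthickening _
  have hKm : MeasurableSet K := hK.isClosed.measurableSet
  have hfi : Integrable (K.indicator f) μ :=
    (integrable_indicator_iff hKm).2 (hf.integrableOn_compact_subset hrΩ hK)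
  have hgi : Integrable (K.indicator g) μ :=
    (integrable_indicator_iff hKm).2 (hg.integrableOn_compact_subset hrΩ hK)
  have hgn : Integrable (fun x => ‖K.indicator g x‖) μ := hgi.norm
  have hφ0 : ∀ x, x ∉ tsupport φ → φ x = 0 ∧ fderiv ℝ φ x = 0 := by
    intro x hx
    exact ⟨image_eq_zero_of_notMem_tsupport hx, by
      by_contra h
      exact hx (support_fderiv_subset ℝ (by simpa using h))⟩
  have hφ1 : ContDiff ℝ 1 φ := hφ.of_le (by exact_mod_cast le_top)
  have hdφc : Continuous (fun x => fderiv ℝ φ x v) :=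
    (hφ1.continuous_fderiv one_ne_zero).clm_apply continuous_const
  have hdφs : HasCompactSupport (fun x => fderiv ℝ φ x v) := hφc.fderiv_apply ℝ v
  have hdF : Continuous (deriv F) := hF.continuous_deriv le_rfl
  have hpos : ∀ j : ℕ, 0 < r / (j + 2) := fun j => by positivity
  let ρ : ℕ → ContDiffBump (0 : E) := fun j =>
    ⟨r / (j + 2) / 2, r / (j + 2), half_pos (hpos j), half_lt_self (hpos j)⟩
  have hρr : ∀ j, (ρ j).rOut ≤ r := fun j => by
    change r / (j + 2) ≤ r
    exact div_le_self hr.le (by have : (0:ℝ) ≤ j := j.cast_nonneg; linarith)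
  have hρ0 : Tendsto (fun j => (ρ j).rOut) atTop (𝓝 0) := by
    change Tendsto (fun j : ℕ => r / ((j : ℝ) + 2)) atTop (𝓝 0)
    exact tendsto_const_nhds.div_atTop
      (tendsto_atTop_add_const_right _ _ tendsto_natCast_atTop_atTop)
  have hρ2 : ∀ᶠ j in atTop, (ρ j).rOut ≤ 2 * (ρ j).rIn := Eventually.of_forall fun j => by
    change r / ((j : ℝ) + 2) ≤ 2 * (r / (j + 2) / 2)
    linarith
  set fj : ℕ → E → ℝ := fun j => (ρ j).normed μ ⋆[lsmul ℝ ℝ, μ] K.indicator f with hfj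
  set gj : ℕ → E → ℝ := fun j => (ρ j).normed μ ⋆[lsmul ℝ ℝ, μ] K.indicator g with hgj
  set Gj : ℕ → E → ℝ := fun j => (ρ j).normed μ ⋆[lsmul ℝ ℝ, μ] (fun x => ‖K.indicator g x‖)
    with hGj
  have hfl : ∀ᵐ x ∂μ, Tendsto (fun j => fj j x) atTop (𝓝 (K.indicator f x)) :=
    ContDiffBump.ae_convolution_tendsto_right_of_locallyIntegrable hρ0 hρ2 hfi.locallyIntegrable
  have hgl : ∀ᵐ x ∂μ, Tendsto (fun j => gj j x) atTop (𝓝 (K.indicator g x)) :=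
    ContDiffBump.ae_convolution_tendsto_right_of_locallyIntegrable hρ0 hρ2 hgi.locallyIntegrable
  have hGl : ∀ᵐ x ∂μ, Tendsto (fun j => Gj j x) atTop (𝓝 ‖K.indicator g x‖) :=
    ContDiffBump.ae_convolution_tendsto_right_of_locallyIntegrable hρ0 hρ2 hgn.locallyIntegrable
  have hfjd : ∀ j, ContDiff ℝ 1 (fj j) := fun j =>
    (ρ j).hasCompactSupport_normed.contDiff_convolution_left _ (ρ j).contDiff_normed
      hfi.locallyIntegrable
  have hgjc : ∀ j, Continuous (gj j) := fun j =>
    ((ρ j).hasCompactSupport_normed.contDiff_convolution_left (n := 0) _ (ρ j).contDiff_normed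
      hgi.locallyIntegrable).continuous
  have hρi : ∀ j, Integrable ((ρ j).normed μ) μ := fun j => (ρ j).integrable_normed
  have hGji : ∀ j, Integrable (Gj j) μ := fun j => (hρi j).integrable_convolution _ hgn
  have hGint : ∀ j, ∫ x, Gj j x ∂μ = ∫ x, ‖K.indicator g x‖ ∂μ := fun j => by
    rw [hGj]
    simp only
    rw [integral_convolution _ (hρi j) hgn, (ρ j).integral_normed]
    simp
  have hgG : ∀ j x, |gj j x| ≤ Gj j x := fun j x => by
    simp only [hgj, hGj, convolution_def]
    rw [← Real.norm_eq_abs]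
    refine (norm_integral_le_integral_norm _).trans (le_of_eq ?_)
    congr 1; ext t
    simp [abs_of_nonneg ((ρ j).nonneg_normed t)]
  obtain ⟨M, hM⟩ : ∃ M, ∀ x, ‖φ x‖ ≤ M := hφc.exists_bound_of_continuous hφ.continuous
  have hM0 : 0 ≤ M := (norm_nonneg _).trans (hM 0)
  have hid : ∀ j, ∫ x, F (fj j x) * fderiv ℝ φ x v ∂μ
      = - ∫ x, deriv F (fj j x) * gj j x * φ x ∂μ := by
    intro j
    have hFf : ContDiff ℝ 1 (fun x => F (fj j x)) := hF.comp (hfjd j)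
    have hdc : Continuous (fun x => fderiv ℝ (fun x => F (fj j x)) x v) :=
      (hFf.continuous_fderiv one_ne_zero).clm_apply continuous_const
    rw [integral_mul_fderiv_eq_neg_fderiv_mul_of_integrable
      ((hdc.mul hφ.continuous).integrable_of_hasCompactSupport hφc.mul_left)
      ((hFf.continuous.mul hdφc).integrable_of_hasCompactSupport hdφs.mul_left)
      ((hFf.continuous.mul hφ.continuous).integrable_of_hasCompactSupport hφc.mul_left)
      (fun x _ => hFf.differentiable one_ne_zero x)
      (fun x _ => hφ1.differentiable one_ne_zero x)]
    congr 2; ext x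
    by_cases hx : x ∈ tsupport φ
    · have hball : Metric.closedBall x (ρ j).rOut ⊆ K :=
        (Metric.closedBall_subset_closedBall (hρr j)).trans
          (Metric.closedBall_subset_cthickening hx r)
      obtain ⟨h1, h2⟩ := fderiv_moll hK hrΩ hf hfg (ρ j) x hball
      have h3 := ((hF.differentiable one_ne_zero (fj j x)).hasDerivAt).comp_hasFDerivAt x h1
      have h4 : fderiv ℝ (fun x => F (fj j x)) x v = deriv F (fj j x) * gj j x := by
        have h5 := h3.fderiv
        simp only [Function.comp_def] at h5
        rw [h5]
        simp only [_root_.smul_apply, smul_eq_mul]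
        rw [h2]
      rw [h4]
    · simp [(hφ0 x hx).1]
  have L1 : Tendsto (fun j => ∫ x, F (fj j x) * fderiv ℝ φ x v ∂μ) atTop
      (𝓝 (∫ x, F (K.indicator f x) * fderiv ℝ φ x v ∂μ)) := by
    refine tendsto_integral_of_dominated_convergence (fun x => C * ‖fderiv ℝ φ x v‖) ?_ ?_ ?_ ?_
    · intro j
      exact ((hF.continuous.comp (hfjd j).continuous).mul hdφc).aestronglyMeasurable
    · exact ((hdφc.integrable_of_hasCompactSupport hdφs).norm).const_mul C
    · intro j
      refine Eventually.of_forall fun x => ?_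
      rw [norm_mul]
      exact mul_le_mul_of_nonneg_right (hFC _) (norm_nonneg _)
    · filter_upwards [hfl] with x hx
      exact ((hF.continuous.tendsto _).comp hx).mul_const _
  have L2 : Tendsto (fun j => ∫ x, deriv F (fj j x) * gj j x * φ x ∂μ) atTop
      (𝓝 (∫ x, deriv F (K.indicator f x) * K.indicator g x * φ x ∂μ)) := by
    refine gdct (G := fun j x => M * Gj j x) (G0 := fun x => M * ‖K.indicator g x‖)
      ?_ (fun j => (hGji j).const_mul M) (hgn.const_mul M) ?_ ?_ ?_ ?_
    · intro j
      exact (((hdF.comp (hfjd j).continuous).mul (hgjc j)).mul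
        hφ.continuous).aestronglyMeasurable
    · intro j
      refine Eventually.of_forall fun x => ?_
      rw [abs_mul, abs_mul, mul_comm]
      refine mul_le_mul (hM x) ?_ (by positivity) hM0
      calc |deriv F (fj j x)| * |gj j x| ≤ 1 * |gj j x| :=
            mul_le_mul_of_nonneg_right (hF' _) (abs_nonneg _)
        _ ≤ Gj j x := by rw [one_mul]; exact hgG j x
    · filter_upwards [hfl, hgl] with x h1 h2
      exact (((hdF.tendsto _).comp h1).mul h2).mul_const _
    · filter_upwards [hGl] with x h1
      exact h1.const_mul M
    · simp_rw [integral_const_mul, hGint]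
      exact tendsto_const_nhds
  have L3 := tendsto_nhds_unique L1 (by simpa only [hid] using L2.neg)
  have e1 : ∀ x, F (K.indicator f x) * fderiv ℝ φ x v = F (f x) * fderiv ℝ φ x v := by
    intro x
    by_cases hx : x ∈ tsupport φ
    · rw [Set.indicator_of_mem (hsub hx)]
    · simp [(hφ0 x hx).2]
  have e2 : ∀ x, deriv F (K.indicator f x) * K.indicator g x * φ x
      = deriv F (f x) * g x * φ x := by
    intro x
    by_cases hx : x ∈ tsupport φ
    · rw [Set.indicator_of_mem (hsub hx), Set.indicator_of_mem (hsub hx)]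
    · simp [(hφ0 x hx).1]
  simpa only [e1, e2] using L3

lemma weak_deriv_zero {Ω : Set E} {f g : E → ℝ} {v : E} (hΩ : IsOpen Ω)
    (hf : LocallyIntegrableOn f Ω μ) (hg : LocallyIntegrableOn g Ω μ) (hfm : Measurable f)
    (hfg : ∀ φ : E → ℝ, ContDiff ℝ (⊤ : ℕ∞) φ → HasCompactSupport φ →
      tsupport φ ⊆ Ω → ∫ x in Ω, f x * fderiv ℝ φ x v ∂μ = - ∫ x in Ω, φ x * g x ∂μ) :
    ∀ᵐ x ∂μ, x ∈ Ω → f x = 0 → g x = 0 := by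
  have hS : MeasurableSet {x | f x = 0} := hfm (measurableSet_singleton 0)
  have hgS : LocallyIntegrableOn ({x | f x = 0}.indicator g) Ω μ := by
    intro x hx
    obtain ⟨s, hs, hi⟩ := hg x hx
    exact ⟨s, hs, hi.indicator hS⟩
  have := hΩ.ae_eq_zero_of_integral_contDiff_smul_eq_zero hgS ?_
  · filter_upwards [this] with x h1 h2 h3
    have := h1 h2
    rwa [Set.indicator_of_mem (by exact h3)] at this
  intro φ hφ hφc hφΩ
  have hφ1 : ContDiff ℝ 1 φ := hφ.of_le (by exact_mod_cast le_top)
  have hdφc : Continuous (fun x => fderiv ℝ φ x v) :=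
    (hφ1.continuous_fderiv one_ne_zero).clm_apply continuous_const
  have hdφs : HasCompactSupport (fun x => fderiv ℝ φ x v) := hφc.fderiv_apply ℝ v
  have hdφi := hdφc.integrable_of_hasCompactSupport (μ := μ) hdφs
  have hφg : Integrable (fun x => g x * φ x) μ := by
    have h1 : IntegrableOn (fun x => g x * φ x) (tsupport φ) μ :=
      (hg.integrableOn_compact_subset hφΩ hφc.isCompact).mul_continuousOn
        hφ.continuous.continuousOn hφc.isCompact
    rw [← integrable_indicator_iff (isClosed_tsupport φ).measurableSet] at h1
    refine h1.congr (Eventually.of_forall fun x => ?_)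
    by_cases hx : x ∈ tsupport φ
    · simp [hx]
    · simp [hx, image_eq_zero_of_notMem_tsupport hx]
  let F : ℕ → ℝ → ℝ := fun N t => Real.arctan ((N + 1) * t) / (N + 1)
  have hN : ∀ N : ℕ, (0:ℝ) < N + 1 := fun N => by positivity
  have hFd : ∀ N t, HasDerivAt (F N) (1 / (1 + ((N + 1) * t) ^ 2)) t := by
    intro N t
    have h1 : HasDerivAt (fun t : ℝ => ((N:ℝ) + 1) * t) (N + 1) t := by
      simpa using (hasDerivAt_id t).const_mul ((N:ℝ) + 1)
    have h2 := (h1.arctan).div_const ((N:ℝ) + 1)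
    refine h2.congr_deriv ?_
    have := (hN N).ne'
    field_simp
  have hFc : ∀ N, ContDiff ℝ 1 (F N) := fun N =>
    (Real.contDiff_arctan.comp (contDiff_const.mul contDiff_id)).div_const _
  have hFb : ∀ N t, |F N t| ≤ (Real.pi / 2) / (N + 1) := by
    intro N t
    simp only [F, abs_div, abs_of_pos (hN N)]
    gcongr
    exact abs_le.2 ⟨(Real.neg_pi_div_two_lt_arctan _).le, (Real.arctan_lt_pi_div_two _).le⟩
  have hF'b : ∀ N t, |deriv (F N) t| ≤ 1 := by
    intro N t
    rw [(hFd N t).deriv, abs_of_nonneg (by positivity)]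
    exact div_le_one_of_le₀ (by nlinarith [sq_nonneg (((N:ℝ) + 1) * t)]) (by positivity)
  have hid := fun N => chain_rule hΩ hf hg hfg (hFc N) (hFb N) (hF'b N) hφ hφc hφΩ
  have hlim0 : Tendsto (fun N : ℕ => (Real.pi / 2) / ((N:ℝ) + 1)) atTop (𝓝 0) :=
    tendsto_const_nhds.div_atTop
      (tendsto_atTop_add_const_right _ _ tendsto_natCast_atTop_atTop)
  have L1 : Tendsto (fun N => ∫ x, F N (f x) * fderiv ℝ φ x v ∂μ) atTop (𝓝 0) := by
    have hz : Tendsto (fun N : ℕ => (Real.pi / 2) / ((N:ℝ) + 1) * ∫ x, ‖fderiv ℝ φ x v‖ ∂μ)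
        atTop (𝓝 0) := by simpa using hlim0.mul_const (∫ x, ‖fderiv ℝ φ x v‖ ∂μ)
    refine squeeze_zero_norm (fun N => ?_) hz
    rw [← integral_const_mul]
    refine norm_integral_le_of_norm_le (hdφi.norm.const_mul _) (Eventually.of_forall fun x => ?_)
    rw [norm_mul]
    exact mul_le_mul_of_nonneg_right (hFb N _) (norm_nonneg _)
  have L2 : Tendsto (fun N => ∫ x, deriv (F N) (f x) * g x * φ x ∂μ) atTop
      (𝓝 (∫ x, φ x • {x | f x = 0}.indicator g x ∂μ)) := by
    refine tendsto_integral_of_dominated_convergence (fun x => ‖g x * φ x‖) ?_ hφg.norm ?_ ?_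
    · intro N
      simp_rw [mul_assoc]
      exact ((((hFc N).continuous_deriv le_rfl).measurable.comp
        hfm).aestronglyMeasurable).mul hφg.1
    · intro N
      refine Eventually.of_forall fun x => ?_
      rw [mul_assoc, norm_mul]
      exact mul_le_of_le_one_left (norm_nonneg _) (hF'b N _)
    · refine Eventually.of_forall fun x => ?_
      simp_rw [mul_assoc, (hFd _ _).deriv]
      by_cases hx : f x = 0
      · simp [hx, mul_comm]
      · have ht : Tendsto (fun N : ℕ => 1 / (1 + (((N:ℝ) + 1) * f x) ^ 2)) atTop (𝓝 0) := by
          refine tendsto_const_nhds.div_atTop (tendsto_atTop_add_const_left _ _ ?_)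
          simp_rw [mul_pow]
          refine Tendsto.atTop_mul_const (by positivity) ?_
          exact (tendsto_pow_atTop two_ne_zero).comp
            (tendsto_atTop_add_const_right _ _ tendsto_natCast_atTop_atTop)
        simpa [hx] using ht.mul_const (g x * φ x)
  have := tendsto_nhds_unique L1 (by simpa only [hid] using L2.neg)
  linarith
end

lemma scalar_weak {n : ℕ} {f : EuclideanSpace ℝ (Fin n) → ℝ}
    {g : EuclideanSpace ℝ (Fin n) → EuclideanSpace ℝ (Fin n)}
    {Ω : Set (EuclideanSpace ℝ (Fin n))} (h : HasWeakGradientOn n f g Ω) (i : Fin n)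
    {φ : EuclideanSpace ℝ (Fin n) → ℝ} (hφ : ContDiff ℝ (⊤ : ℕ∞) φ) (hφc : HasCompactSupport φ)
    (hφΩ : tsupport φ ⊆ Ω) :
    IntegrableOn (fun x => f x * fderiv ℝ φ x (EuclideanSpace.single i 1)) Ω volume ∧
    IntegrableOn (fun x => φ x * g x i) Ω volume ∧
    ∫ x in Ω, f x * fderiv ℝ φ x (EuclideanSpace.single i 1) = - ∫ x in Ω, φ x * g x i := by
  obtain ⟨hf, hg, hfg⟩ := h
  have hφ1 : ContDiff ℝ 1 φ := hφ.of_le (by exact_mod_cast le_top)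
  have hgr : ∀ x, gradient φ x i = fderiv ℝ φ x (EuclideanSpace.single i 1) := by
    intro x
    have h1 : inner ℝ (gradient φ x) (EuclideanSpace.single i (1:ℝ))
        = fderiv ℝ φ x (EuclideanSpace.single i 1) := by
      rw [gradient, InnerProductSpace.toDual_symm_apply]
    rw [← h1, EuclideanSpace.inner_single_right]
    simp
  have hgc : Continuous (gradient φ) := by
    have := hφ1.continuous_fderiv one_ne_zero
    exact (InnerProductSpace.toDual ℝ (EuclideanSpace ℝ (Fin n))).symm.continuous.comp this
  have hm : MeasurableSet (tsupport φ) := (isClosed_tsupport φ).measurableSet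
  have i1 : Integrable (fun x => f x • gradient φ x) volume := by
    have h1 : IntegrableOn (fun x => f x • gradient φ x) (tsupport φ) volume :=
      (hf.integrableOn_compact_subset hφΩ hφc.isCompact).smul_continuousOn
        hgc.continuousOn hφc.isCompact
    refine (integrableOn_iff_integrable_of_support_subset ?_).1 h1
    intro x hx
    by_contra hx'
    have : fderiv ℝ φ x = 0 := by
      by_contra h
      exact hx' (support_fderiv_subset ℝ (by simpa using h))
    exact hx (by simp [gradient, this])
  have i2 : Integrable (fun x => φ x • g x) volume := by
    have h1 : IntegrableOn (fun x => φ x • g x) (tsupport φ) volume :=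
      (hg.integrableOn_compact_subset hφΩ hφc.isCompact).continuousOn_smul
        hφ.continuous.continuousOn hφc.isCompact
    refine (integrableOn_iff_integrable_of_support_subset ?_).1 h1
    intro x hx
    by_contra hx'
    exact hx (by simp [image_eq_zero_of_notMem_tsupport hx'])
  have key := congrArg (EuclideanSpace.proj (𝕜 := ℝ) i) (hfg φ hφ hφc hφΩ)
  rw [map_neg, ← ContinuousLinearMap.integral_comp_comm _ i1.integrableOn,
    ← ContinuousLinearMap.integral_comp_comm _ i2.integrableOn] at key
  have j1 := (EuclideanSpace.proj i : EuclideanSpace ℝ (Fin n) →L[ℝ] ℝ).integrable_comp i1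
  have j2 := (EuclideanSpace.proj i : EuclideanSpace ℝ (Fin n) →L[ℝ] ℝ).integrable_comp i2
  simp only [PiLp.proj_apply, PiLp.smul_apply, smul_eq_mul, hgr] at key j1 j2
  exact ⟨j1.integrableOn, j2.integrableOn, key⟩

end Helpers

/-- If `u : Ω → ℝ` is measurable, finite a.e., and `T_k(u) ∈ W^{1,p}_loc(Ω)` for all `k > 0`
(with weak gradients `g k`), then the gradient `∇u(x) := D(T_k u)(x)` for `|u(x)| < k` is
well defined: for `0 < k ≤ m` the weak gradients of `T_k u` and `T_m u` agree a.e. on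
`{x ∈ Ω : |u x| < k}`. -/
theorem weak_gradients_of_truncations_agree (n : ℕ)
    (Ω : Set (EuclideanSpace ℝ (Fin n))) (hΩ : IsOpen Ω)
    (u : EuclideanSpace ℝ (Fin n) → ℝ) (hu : Measurable u)
    (k m : ℝ) (hk : 0 < k) (hkm : k ≤ m)
    (gk gm : EuclideanSpace ℝ (Fin n) → EuclideanSpace ℝ (Fin n))
    (hgk : HasWeakGradientOn n (fun x => trunc k (u x)) gk Ω)
    (hgm : HasWeakGradientOn n (fun x => trunc m (u x)) gm Ω) :
    ∀ᵐ x ∂(volume.restrict {x ∈ Ω | |u x| < k}), gk x = gm x := by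
  have hmeas : ∀ k : ℝ, Measurable (fun x => trunc k (u x)) := fun k =>
    measurable_const.max (hu.min measurable_const)
  have hS : MeasurableSet {x | |u x| < k} := measurableSet_lt hu.abs measurable_const
  have hset : MeasurableSet {x ∈ Ω | |u x| < k} := hΩ.measurableSet.inter hS
  have main : ∀ i : Fin n, ∀ᵐ x, x ∈ Ω → trunc k (u x) - trunc m (u x) = 0 →
      gk x i - gm x i = 0 := by
    intro i
    have hcoord : ∀ {g : EuclideanSpace ℝ (Fin n) → EuclideanSpace ℝ (Fin n)},
        LocallyIntegrableOn g Ω volume → LocallyIntegrableOn (fun x => g x i) Ω volume := by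
      intro g hg x hx
      obtain ⟨s, hs, hi⟩ := hg x hx
      exact ⟨s, hs,
        (EuclideanSpace.proj i : EuclideanSpace ℝ (Fin n) →L[ℝ] ℝ).integrable_comp hi⟩
    refine weak_deriv_zero (v := EuclideanSpace.single i (1:ℝ)) hΩ (hgk.1.sub hgm.1)
      ((hcoord hgk.2.1).sub (hcoord hgm.2.1)) ((hmeas k).sub (hmeas m)) ?_
    intro φ hφ hφc hφΩ
    obtain ⟨a1, a2, a3⟩ := scalar_weak hgk i hφ hφc hφΩ
    obtain ⟨b1, b2, b3⟩ := scalar_weak hgm i hφ hφc hφΩ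
    simp only [sub_mul, mul_sub]
    rw [integral_sub a1 b1, integral_sub a2 b2, a3, b3]
    ring
  rw [ae_restrict_iff' hset]
  filter_upwards [ae_all_iff.2 main] with x hx hxS
  ext i
  have h1 := abs_lt.1 hxS.2
  have h2 : ∀ l, k ≤ l → trunc l (u x) = u x := by
    intro l hl
    rw [trunc, min_eq_left (by linarith), max_eq_right (by linarith)]
  have := hx i hxS.1 (by rw [h2 k le_rfl, h2 m hkm, sub_self])
  linarith
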